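/- Let p, q, a, b ∈ I be pairwise distinct IRIs and ?x a variable. The pattern (() OPT (?x, p, a)) OPT (?x, q, b), where () is the empty group pattern, is not monotonic: there exist RDF graphs G₁ ⊆ G₂ with ⟦P⟧_{G₁} ⊄ ⟦P⟧_{G₂}. -/

import Mathlib

namespace SPARQL

/-- Kinds of RDF constants: IRIs, blank nodes, literals. -/
inductive Kind : Type
  | iri | blank | lit
deriving DecidableEq

/-- The countably infinite set `U` of constants, partitioned into the three
infinite sets of IRIs `I` (kind `iri`), blank nodes `B` (kind `blank`) and
literals `L` (kind `lit`). -/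
abbrev Const := Kind × ℕ

/-- The countably infinite set `V` of variables (disjoint from `U`). -/
abbrev Var := ℕ

/-- A mapping: a partial function from variables to constants with finite domain. -/
structure Mapping where
  toFun : Var → Option Const
  finite : {x : Var | toFun x ≠ none}.Finite

/-- The domain of a mapping. -/
def Mapping.dom (μ : Mapping) : Set Var := {x | μ.toFun x ≠ none}

/-- Two mappings are compatible if they agree on the intersection of their domains. -/
def Compatible (μ₁ μ₂ : Mapping) : Prop :=
  ∀ x ∈ μ₁.dom ∩ μ₂.dom, μ₁.toFun x = μ₂.toFun x

/-- Union of two mappings (preferring the first one where both are defined). -/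
def Mapping.union (μ₁ μ₂ : Mapping) : Mapping where
  toFun := fun x => match μ₁.toFun x with
    | some u => some u
    | none => μ₂.toFun x
  finite := by
    apply (μ₁.finite.union μ₂.finite).subset
    intro x hx
    simp only [Set.mem_setOf_eq] at hx
    simp only [Set.mem_union, Set.mem_setOf_eq]
    by_cases h1 : μ₁.toFun x = none
    · right; intro h2; apply hx; simp [h1, h2]
    · left; exact h1

/-- A term: either a constant or a variable. -/
inductive Term : Type
  | const : Const → Term
  | var : Var → Term

/-- A triple pattern. -/
abbrev TriplePat := Term × Term × Term

/-- An RDF graph: a finite set of triples of constants. -/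
abbrev Graph := Finset (Const × Const × Const)

/-- Variables of a term. -/
def Term.vars : Term → Set Var
  | .const _ => ∅
  | .var x => {x}

/-- Variables of a triple pattern. -/
def tripleVars (t : TriplePat) : Set Var := t.1.vars ∪ t.2.1.vars ∪ t.2.2.vars

/-- Apply a mapping to a term. -/
def Term.app (μ : Mapping) : Term → Option Const
  | .const c => some c
  | .var x => μ.toFun x

/-- Three truth values: true, false, error. -/
inductive TV : Type
  | t | f | e
deriving DecidableEq

/-- Kleene negation. -/
def TV.neg : TV → TV
  | .t => .f
  | .f => .t
  | .e => .e

/-- Kleene conjunction. -/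
def TV.and : TV → TV → TV
  | .f, _ => .f
  | _, .f => .f
  | .t, .t => .t
  | _, _ => .e

/-- Kleene disjunction. -/
def TV.or : TV → TV → TV
  | .t, _ => .t
  | _, .t => .t
  | .f, .f => .f
  | _, _ => .e

/-- Constraints: Boolean combinations of the atomic constraints
`bound(?x)`, `?x = c`, `?x = ?y`, `isIRI(?x)`, `isBlank(?x)`, `isLiteral(?x)`. -/
inductive Constraint : Type
  | bound : Var → Constraint
  | eqC : Var → Const → Constraint
  | eqV : Var → Var → Constraint
  | isIRI : Var → Constraint
  | isBlank : Var → Constraint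
  | isLiteral : Var → Constraint
  | and : Constraint → Constraint → Constraint
  | or : Constraint → Constraint → Constraint
  | not : Constraint → Constraint

/-- Three-valued evaluation of a constraint on a mapping. -/
def Constraint.eval (μ : Mapping) : Constraint → TV
  | .bound x => match μ.toFun x with
      | some _ => .t
      | none => .f
  | .eqC x c => match μ.toFun x with
      | some u => if u = c then .t else .f
      | none => .e
  | .eqV x y => match μ.toFun x, μ.toFun y with
      | some u, some v => if u = v then .t else .f
      | _, _ => .e
  | .isIRI x => match μ.toFun x with
      | some u => if u.1 = Kind.iri then .t else .f
      | none => .e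
  | .isBlank x => match μ.toFun x with
      | some u => if u.1 = Kind.blank then .t else .f
      | none => .e
  | .isLiteral x => match μ.toFun x with
      | some u => if u.1 = Kind.lit then .t else .f
      | none => .e
  | .and C D => (C.eval μ).and (D.eval μ)
  | .or C D => (C.eval μ).or (D.eval μ)
  | .not C => (C.eval μ).neg

/-- The empty mapping `μ∅`. -/
def Mapping.empty : Mapping :=
  ⟨fun _ => none, Set.Finite.subset (Set.finite_empty) (by intro x hx; exact absurd rfl hx)⟩

/-- SPARQL graph patterns (including the empty group pattern `()`). -/
inductive Pattern : Type
  | triple : TriplePat → Pattern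
  | empty : Pattern
  | and : Pattern → Pattern → Pattern
  | union : Pattern → Pattern → Pattern
  | opt : Pattern → Pattern → Pattern
  | filter : Pattern → Constraint → Pattern

/-- `μ(t) ∈ G` for a triple pattern `t`. -/
def tripleMatch (μ : Mapping) (t : TriplePat) (G : Graph) : Prop :=
  ∃ s p o : Const, t.1.app μ = some s ∧ t.2.1.app μ = some p ∧ t.2.2.app μ = some o ∧
    (s, p, o) ∈ G

/-- Evaluation of a pattern on an RDF graph: a set of mappings. -/
def Pattern.eval (G : Graph) : Pattern → Set Mapping
  | .triple t => {μ | μ.dom = tripleVars t ∧ tripleMatch μ t G}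
  | .empty => {Mapping.empty}
  | .and P₁ P₂ =>
      {μ | ∃ μ₁ ∈ P₁.eval G, ∃ μ₂ ∈ P₂.eval G, Compatible μ₁ μ₂ ∧ μ = μ₁.union μ₂}
  | .union P₁ P₂ => P₁.eval G ∪ P₂.eval G
  | .opt P₁ P₂ =>
      {μ | ∃ μ₁ ∈ P₁.eval G, ∃ μ₂ ∈ P₂.eval G, Compatible μ₁ μ₂ ∧ μ = μ₁.union μ₂} ∪
      {μ₁ ∈ P₁.eval G | ∀ μ₂ ∈ P₂.eval G, ¬ Compatible μ₁ μ₂}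
  | .filter P C => {μ ∈ P.eval G | C.eval μ = TV.t}

/-- A pattern is monotonic if enlarging the graph enlarges the answer set. -/
def Monotonic (P : Pattern) : Prop :=
  ∀ G₁ G₂ : Graph, G₁ ⊆ G₂ → P.eval G₁ ⊆ P.eval G₂

/-- Subsumption of mappings: `μ₁ ⊑ μ₂`. -/
def Mapping.Sub (μ₁ μ₂ : Mapping) : Prop :=
  μ₁.dom ⊆ μ₂.dom ∧ ∀ x ∈ μ₁.dom, μ₁.toFun x = μ₂.toFun x

/-- Subsumption of sets of mappings: `Ω₁ ⊑ Ω₂`. -/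
def SetSub (Ω₁ Ω₂ : Set Mapping) : Prop :=
  ∀ μ₁ ∈ Ω₁, ∃ μ₂ ∈ Ω₂, μ₁.Sub μ₂

/-- A pattern is weakly monotonic if enlarging the graph subsumes the old answers. -/
def WeaklyMonotonic (P : Pattern) : Prop :=
  ∀ G₁ G₂ : Graph, G₁ ⊆ G₂ → SetSub (P.eval G₁) (P.eval G₂)

/-- Variables occurring in the triple patterns of a pattern. -/
def Pattern.vars : Pattern → Set Var
  | .triple t => tripleVars t
  | .empty => ∅
  | .and P Q => P.vars ∪ Q.vars
  | .union P Q => P.vars ∪ Q.vars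
  | .opt P Q => P.vars ∪ Q.vars
  | .filter P _ => P.vars


/-- for pairwise distinct IRIs `p, q, a, b` and a variable `?x`,
the pattern `(() OPT (?x, p, a)) OPT (?x, q, b)` (where `()` is the empty group
pattern) is not monotonic. -/
theorem empty_opt_opt_not_monotonic
    (p q a b : Const) (hp : p.1 = Kind.iri) (hq : q.1 = Kind.iri)
    (ha : a.1 = Kind.iri) (hb : b.1 = Kind.iri)
    (hdist : List.Pairwise (· ≠ ·) [p, q, a, b]) (x : Var) :
    ∃ G₁ G₂ : Graph, G₁ ⊆ G₂ ∧
      ¬ ((Pattern.opt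
          (Pattern.opt Pattern.empty
            (Pattern.triple (Term.var x, Term.const p, Term.const a)))
          (Pattern.triple (Term.var x, Term.const q, Term.const b))).eval G₁ ⊆
        (Pattern.opt
          (Pattern.opt Pattern.empty
            (Pattern.triple (Term.var x, Term.const p, Term.const a)))
          (Pattern.triple (Term.var x, Term.const q, Term.const b))).eval G₂) := by
  refine ⟨∅, {(p, p, a)}, by simp, ?_⟩
  intro h
  have h0 : Mapping.empty ∈ (Pattern.opt
          (Pattern.opt Pattern.empty
            (Pattern.triple (Term.var x, Term.const p, Term.const a)))
          (Pattern.triple (Term.var x, Term.const q, Term.const b))).eval ∅ := by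
    refine Or.inr ⟨Or.inr ⟨rfl, ?_⟩, ?_⟩
    · rintro μ ⟨_, s, u, o, _, _, _, hm⟩
      simp at hm
    · rintro μ ⟨_, s, u, o, _, _, _, hm⟩
      simp at hm
  have key : ∀ (μ₁ μ₂ : Mapping) (c : Const), μ₂.toFun x = some c →
      Mapping.empty ≠ μ₁.union μ₂ := by
    intro μ₁ μ₂ c hc he
    have h1 : none = (μ₁.union μ₂).toFun x := congrArg (fun m => m.toFun x) he
    simp only [Mapping.union] at h1
    cases h2 : μ₁.toFun x <;> simp [h2, hc] at h1
  rcases h h0 with ⟨μ₁, _, μ₂, ⟨_, s, u, o, hs, _⟩, _, he⟩ | ⟨h1, _⟩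
  · exact key μ₁ μ₂ s hs he
  · rcases h1 with ⟨μ₁, _, μ₂, ⟨_, s, u, o, hs, _⟩, _, he⟩ | ⟨_, h2⟩
    · exact key μ₁ μ₂ s hs he
    · refine h2 ⟨fun y => if y = x then some p else none, ?_⟩ ⟨?_, p, p, a, ?_, rfl, rfl, ?_⟩ ?_
      · exact (Set.finite_singleton x).subset (by intro y hy; simpa using hy)
      · ext y
        simp [Mapping.dom, tripleVars, Term.vars]
      · simp [Term.app]
      · simp
      · rintro y ⟨hy, _⟩
        exact absurd rfl hy

end SPARQL
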